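/- (Theorem 4.4-(1), Solution of the Bellman equation.) In an MG-SPA, if v : S → ℝ satisfies the Bellman optimality equation L v = v, then v is the optimal value function: for every s ∈ S, v(s) = ⨆_{π} ⨅_{ρ} v_{π,ρ}(s), where the supremum is over all agent policies π : S → (B → stdSimplex ℝ A) and the infimum is over all adversary policies ρ : S → stdSimplex ℝ B. -/

import Mathlib

open scoped BigOperators

section MGSPA

variable {S A B : Type*}

/-- The induced one-step expected reward of the joint policy `(π, ρ)`:
`r_{π,ρ}(s) = ∑ b, (ρ s) b * ∑ a, (π s b) a * r s a b`. -/
noncomputable def rPol [Fintype A] [Fintype B]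
    (r : S → A → B → ℝ)
    (π : S → B → stdSimplex ℝ A) (ρ : S → stdSimplex ℝ B) : S → ℝ :=
  fun s => ∑ b, (ρ s : B → ℝ) b * ∑ a, (π s b : A → ℝ) a * r s a b

/-- The induced state-transition matrix of the joint policy `(π, ρ)`:
`P_{π,ρ}(s, s') = ∑ b, (ρ s) b * ∑ a, (π s b) a * p s a b s'`. -/
noncomputable def PPol [Fintype A] [Fintype B]
    (p : S → A → B → S → ℝ)
    (π : S → B → stdSimplex ℝ A) (ρ : S → stdSimplex ℝ B) : Matrix S S ℝ :=
  fun s s' => ∑ b, (ρ s : B → ℝ) b * ∑ a, (π s b : A → ℝ) a * p s a b s'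

/-- The value function of the joint policy `(π, ρ)`:
`v_{π,ρ}(s) = ∑' t, γ^t * ((P_{π,ρ}^t) *ᵥ r_{π,ρ}) s`. -/
noncomputable def vFn [Fintype S] [DecidableEq S] [Fintype A] [Fintype B]
    (γ : ℝ) (r : S → A → B → ℝ) (p : S → A → B → S → ℝ)
    (π : S → B → stdSimplex ℝ A) (ρ : S → stdSimplex ℝ B) : S → ℝ :=
  fun s => ∑' t : ℕ, γ ^ t * (((PPol p π ρ) ^ t).mulVec (rPol r π ρ)) s

/-- The minimax (Shapley) Bellman operator of the MG-SPA. -/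
noncomputable def Lop [Fintype S] [Fintype A] [Fintype B]
    (γ : ℝ) (r : S → A → B → ℝ) (p : S → A → B → S → ℝ)
    (v : S → ℝ) : S → ℝ :=
  fun s => ⨆ x : B → stdSimplex ℝ A, ⨅ y : stdSimplex ℝ B,
    ∑ b, (y : B → ℝ) b * ∑ a, (x b : A → ℝ) a *
      (r s a b + γ * ∑ s', p s a b s' * v s')

end MGSPA

section Auxiliary

theorem iSup_iInf_eq_of_saddle {X Y : Type*} (f : X → Y → ℝ) (x₀ : X) (y₀ : Y) (c : ℝ)
    (hbdd : ∀ x, BddBelow (Set.range (f x))) (hx : ∀ y, c ≤ f x₀ y) (hy : ∀ x, f x y₀ ≤ c) :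
    ⨆ x, ⨅ y, f x y = c := by
  have : Nonempty X := ⟨x₀⟩
  have : Nonempty Y := ⟨y₀⟩
  have hle : ∀ x, ⨅ y, f x y ≤ c := fun x => (ciInf_le (hbdd x) y₀).trans (hy x)
  refine le_antisymm (ciSup_le hle) ?_
  refine (le_ciInf hx).trans (le_ciSup (f := fun x => ⨅ y, f x y) ?_ x₀)
  exact ⟨c, by rintro _ ⟨x, rfl⟩; exact hle x⟩

theorem le_sum_stdSimplex {X : Type*} [Fintype X] (w : stdSimplex ℝ X) {f : X → ℝ} {m : ℝ}
    (h : ∀ i, m ≤ f i) : m ≤ ∑ i, (w : X → ℝ) i * f i := by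
  calc m = ∑ i, (w : X → ℝ) i * m := by rw [← Finset.sum_mul, stdSimplex.sum_eq_one w, one_mul]
    _ ≤ _ := Finset.sum_le_sum fun i _ => mul_le_mul_of_nonneg_left (h i) (w.2.1 i)

theorem sum_stdSimplex_le {X : Type*} [Fintype X] (w : stdSimplex ℝ X) {f : X → ℝ} {m : ℝ}
    (h : ∀ i, f i ≤ m) : ∑ i, (w : X → ℝ) i * f i ≤ m := by
  calc _ ≤ ∑ i, (w : X → ℝ) i * m :=
        Finset.sum_le_sum fun i _ => mul_le_mul_of_nonneg_left (h i) (w.2.1 i)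
    _ = m := by rw [← Finset.sum_mul, stdSimplex.sum_eq_one w, one_mul]

theorem sum_vertex_mul {X : Type*} [Fintype X] [DecidableEq X] (i : X) (f : X → ℝ) :
    ∑ j, (stdSimplex.vertex (S := ℝ) i : X → ℝ) j * f j = f i := by
  simp [Pi.single_apply]

section Stochastic

variable {S : Type*} [Fintype S] [DecidableEq S]

theorem mulVec_le_of_rowStochastic {P : Matrix S S ℝ} (hP : P ∈ Matrix.rowStochastic ℝ S)
    {d : S → ℝ} {m : ℝ} (h : ∀ s, d s ≤ m) (s : S) : P.mulVec d s ≤ m :=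
  sum_stdSimplex_le ⟨P s, fun _ => Matrix.nonneg_of_mem_rowStochastic hP,
    Matrix.sum_row_of_mem_rowStochastic hP s⟩ h

theorem nonpos_of_le_discounted_mulVec [Nonempty S] {γ : ℝ} (hγ0 : 0 ≤ γ) (hγ1 : γ < 1)
    {P : Matrix S S ℝ} (hP : P ∈ Matrix.rowStochastic ℝ S) {d : S → ℝ}
    (h : ∀ s, d s ≤ γ * P.mulVec d s) (s : S) : d s ≤ 0 := by
  obtain ⟨s₀, hs₀⟩ := Finite.exists_max d
  have h₁ := h s₀
  have h₂ := mul_le_mul_of_nonneg_left (mulVec_le_of_rowStochastic hP hs₀ s₀) hγ0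
  have h₃ := hs₀ s
  nlinarith

theorem le_of_discounted_comparison [Nonempty S] {γ : ℝ} (hγ0 : 0 ≤ γ) (hγ1 : γ < 1)
    {P : Matrix S S ℝ} (hP : P ∈ Matrix.rowStochastic ℝ S) {R u w : S → ℝ}
    (hu : ∀ s, u s ≤ R s + γ * P.mulVec u s) (hw : ∀ s, R s + γ * P.mulVec w s ≤ w s) (s : S) :
    u s ≤ w s := by
  refine sub_nonpos.mp (nonpos_of_le_discounted_mulVec hγ0 hγ1 hP (d := u - w) (fun s => ?_) s)
  rw [Matrix.mulVec_sub, Pi.sub_apply, Pi.sub_apply, mul_sub]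
  linarith [hu s, hw s]

theorem summable_discounted_pow_mulVec {γ : ℝ} (hγ0 : 0 ≤ γ) (hγ1 : γ < 1)
    {P : Matrix S S ℝ} (hP : P ∈ Matrix.rowStochastic ℝ S) (R : S → ℝ) (s : S) :
    Summable fun t : ℕ => γ ^ t * (P ^ t).mulVec R s := by
  refine Summable.of_norm_bounded
    ((summable_geometric_of_lt_one hγ0 hγ1).mul_right (∑ i, |R i|)) fun t => ?_
  have hR : ∀ i, |R i| ≤ ∑ i, |R i| := fun i =>
    Finset.single_le_sum (f := fun i => |R i|) (fun _ _ => abs_nonneg _) (Finset.mem_univ i)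
  rw [norm_mul, Real.norm_of_nonneg (pow_nonneg hγ0 t), Real.norm_eq_abs]
  refine mul_le_mul_of_nonneg_left (abs_le.mpr ⟨?_, ?_⟩) (pow_nonneg hγ0 t)
  · have := mulVec_le_of_rowStochastic (pow_mem hP t) (d := -R)
      (fun i => (neg_le_abs (R i)).trans (hR i)) s
    rw [Matrix.mulVec_neg, Pi.neg_apply] at this
    linarith
  · exact mulVec_le_of_rowStochastic (pow_mem hP t) (fun i => (le_abs_self _).trans (hR i)) s

theorem tsum_discounted_pow_mulVec {γ : ℝ} (hγ0 : 0 ≤ γ) (hγ1 : γ < 1)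
    {P : Matrix S S ℝ} (hP : P ∈ Matrix.rowStochastic ℝ S) (R : S → ℝ) (s : S) :
    ∑' t : ℕ, γ ^ t * (P ^ t).mulVec R s =
      R s + γ * P.mulVec (fun s' => ∑' t : ℕ, γ ^ t * (P ^ t).mulVec R s') s := by
  have hsum := summable_discounted_pow_mulVec hγ0 hγ1 hP R
  rw [(hsum s).tsum_eq_zero_add]
  congr 1
  · simp
  · simp only [Matrix.mulVec, dotProduct, ← tsum_mul_left] at hsum ⊢
    rw [← Summable.tsum_finsetSum fun i _ => (hsum i).mul_left _, ← tsum_mul_left]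
    refine tsum_congr fun t => ?_
    change γ ^ (t + 1) * (P ^ (t + 1)).mulVec R s =
      γ * ∑ i, P s i * (γ ^ t * (P ^ t).mulVec R i)
    rw [pow_succ' P, ← Matrix.mulVec_mulVec, Matrix.mulVec, dotProduct, Finset.mul_sum,
      Finset.mul_sum]
    exact Finset.sum_congr rfl fun i _ => by ring

end Stochastic

section Policies

variable {S A B : Type*} [Fintype S] [Fintype A] [Fintype B]

theorem PPol_mem_rowStochastic [DecidableEq S] {p : S → A → B → S → ℝ}
    (hp0 : ∀ s a b s', 0 ≤ p s a b s') (hp1 : ∀ s a b, ∑ s', p s a b s' = 1)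
    (π : S → B → stdSimplex ℝ A) (ρ : S → stdSimplex ℝ B) :
    PPol p π ρ ∈ Matrix.rowStochastic ℝ S := by
  rw [Matrix.mem_rowStochastic_iff_sum]
  refine ⟨fun s s' => le_sum_stdSimplex _ fun b => le_sum_stdSimplex _ fun a => hp0 s a b s',
    fun s => ?_⟩
  simp only [PPol]
  rw [Finset.sum_comm]
  simp_rw [← Finset.mul_sum]
  rw [← stdSimplex.sum_eq_one (ρ s)]
  refine Finset.sum_congr rfl fun b _ => ?_
  rw [Finset.sum_comm]
  simp_rw [← Finset.mul_sum, hp1, mul_one]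
  rw [stdSimplex.sum_eq_one (π s b), mul_one]

theorem rPol_add_discounted_mulVec (γ : ℝ) (r : S → A → B → ℝ) (p : S → A → B → S → ℝ)
    (π : S → B → stdSimplex ℝ A) (ρ : S → stdSimplex ℝ B) (v : S → ℝ) (s : S) :
    rPol r π ρ s + γ * (PPol p π ρ).mulVec v s =
      ∑ b, (ρ s : B → ℝ) b * ∑ a, (π s b : A → ℝ) a *
        (r s a b + γ * ∑ s', p s a b s' * v s') := by
  have h : (PPol p π ρ).mulVec v s =
      ∑ b, (ρ s : B → ℝ) b * ∑ a, (π s b : A → ℝ) a * ∑ s', p s a b s' * v s' := by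
    simp only [Matrix.mulVec, dotProduct, PPol, Finset.sum_mul, Finset.mul_sum]
    rw [Finset.sum_comm]
    refine Finset.sum_congr rfl fun b _ => ?_
    rw [Finset.sum_comm]
    exact Finset.sum_congr rfl fun a _ => Finset.sum_congr rfl fun s' _ => by ring
  rw [h, rPol, Finset.mul_sum, ← Finset.sum_add_distrib]
  refine Finset.sum_congr rfl fun b _ => ?_
  rw [mul_left_comm, ← mul_add, Finset.mul_sum, ← Finset.sum_add_distrib]
  congr 1
  exact Finset.sum_congr rfl fun a _ => by ring

theorem vFn_eq_rPol_add [DecidableEq S] {γ : ℝ} (hγ0 : 0 ≤ γ) (hγ1 : γ < 1)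
    (r : S → A → B → ℝ) {p : S → A → B → S → ℝ}
    (hp0 : ∀ s a b s', 0 ≤ p s a b s') (hp1 : ∀ s a b, ∑ s', p s a b s' = 1)
    (π : S → B → stdSimplex ℝ A) (ρ : S → stdSimplex ℝ B) (s : S) :
    vFn γ r p π ρ s = rPol r π ρ s + γ * (PPol p π ρ).mulVec (vFn γ r p π ρ) s :=
  tsum_discounted_pow_mulVec hγ0 hγ1 (PPol_mem_rowStochastic hp0 hp1 π ρ) _ s

theorem bddBelow_range_vFn [DecidableEq S] [Nonempty S] {γ : ℝ} (hγ0 : 0 ≤ γ) (hγ1 : γ < 1)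
    (r : S → A → B → ℝ) {p : S → A → B → S → ℝ}
    (hp0 : ∀ s a b s', 0 ≤ p s a b s') (hp1 : ∀ s a b, ∑ s', p s a b s' = 1)
    (π : S → B → stdSimplex ℝ A) (s : S) :
    BddBelow (Set.range fun ρ : S → stdSimplex ℝ B => vFn γ r p π ρ s) := by
  obtain ⟨m, hm⟩ := (Set.finite_range fun x : S × A × B => r x.1 x.2.1 x.2.2).bddBelow
  refine ⟨m / (1 - γ), ?_⟩
  rintro _ ⟨ρ, rfl⟩
  have hP := PPol_mem_rowStochastic hp0 hp1 π ρ
  refine le_of_discounted_comparison hγ0 hγ1 hP (R := rPol r π ρ) (u := fun _ => m / (1 - γ))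
    (fun s => ?_) (fun s => (vFn_eq_rPol_add hγ0 hγ1 r hp0 hp1 π ρ s).ge) s
  have hr : m ≤ rPol r π ρ s :=
    le_sum_stdSimplex _ fun b => le_sum_stdSimplex _ fun a => hm ⟨(s, a, b), rfl⟩
  have hc : (PPol p π ρ).mulVec (fun _ => m / (1 - γ)) s = m / (1 - γ) := by
    rw [Matrix.mulVec, dotProduct, ← Finset.sum_mul, Matrix.sum_row_of_mem_rowStochastic hP,
      one_mul]
  have hne : 1 - γ ≠ 0 := by linarith
  have hm' : m / (1 - γ) = m + γ * (m / (1 - γ)) := by field_simp; ring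
  rw [hc]
  linarith

/-- Since the agent observes the adversary's action, every stage game has a pure saddle point. -/
theorem exists_saddle [Nonempty A] [Nonempty B] (Q : A → B → ℝ) :
    ∃ (x : B → stdSimplex ℝ A) (y : stdSimplex ℝ B) (c : ℝ),
      (∀ y' : stdSimplex ℝ B, c ≤ ∑ b, (y' : B → ℝ) b * ∑ a, (x b : A → ℝ) a * Q a b) ∧
      (∀ x' : B → stdSimplex ℝ A, ∑ b, (y : B → ℝ) b * ∑ a, (x' b : A → ℝ) a * Q a b ≤ c) := by
  classical
  choose α hα using fun b => Finite.exists_max fun a => Q a b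
  obtain ⟨β, hβ⟩ := Finite.exists_min fun b => Q (α b) b
  refine ⟨fun b => stdSimplex.vertex (α b), stdSimplex.vertex β, Q (α β) β,
    fun y' => ?_, fun x' => ?_⟩
  · refine le_sum_stdSimplex y' fun b => ?_
    rw [sum_vertex_mul]
    exact hβ b
  · rw [sum_vertex_mul]
    exact sum_stdSimplex_le _ (hα β)

end Policies

end Auxiliary

/-- (Theorem 4.4-(1), Solution of the Bellman equation.)  Any fixed point of
the minimax Bellman operator is the optimal value function:
`v s = ⨆ π, ⨅ ρ, v_{π,ρ}(s)` for all `s`. -/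
theorem bellman_fixed_point_is_optimal
    {S A B : Type*} [Fintype S] [DecidableEq S] [Nonempty S]
    [Fintype A] [Nonempty A] [Fintype B] [Nonempty B]
    (γ : ℝ) (hγ0 : 0 ≤ γ) (hγ1 : γ < 1)
    (r : S → A → B → ℝ) (p : S → A → B → S → ℝ)
    (hp0 : ∀ s a b s', 0 ≤ p s a b s')
    (hp1 : ∀ s a b, ∑ s', p s a b s' = 1)
    (v : S → ℝ) (hv : Lop γ r p v = v) :
    ∀ s : S,
      v s =
        ⨆ π : S → B → stdSimplex ℝ A, ⨅ ρ : S → stdSimplex ℝ B, vFn γ r p π ρ s := by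
  have key := fun s => exists_saddle fun a b => r s a b + γ * ∑ s', p s a b s' * v s'
  choose π₀ ρ₀ c hπ₀ hρ₀ using key
  have hc : ∀ s, c s = v s := fun s => by
    rw [← congrFun hv s, Lop]
    refine (iSup_iInf_eq_of_saddle _ (π₀ s) (ρ₀ s) (c s) (fun x => ?_) (hπ₀ s) (hρ₀ s)).symm
    obtain ⟨m, hm⟩ := (Set.finite_range fun b => ∑ a, (x b : A → ℝ) a *
      (r s a b + γ * ∑ s', p s a b s' * v s')).bddBelow
    refine ⟨m, ?_⟩
    rintro _ ⟨y, rfl⟩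
    exact le_sum_stdSimplex y fun b => hm ⟨b, rfl⟩
  have hfix := vFn_eq_rPol_add hγ0 hγ1 r hp0 hp1
  intro s
  refine (iSup_iInf_eq_of_saddle _ π₀ ρ₀ (v s)
    (fun π => bddBelow_range_vFn hγ0 hγ1 r hp0 hp1 π s) (fun ρ => ?_) (fun π => ?_)).symm
  · refine le_of_discounted_comparison hγ0 hγ1 (PPol_mem_rowStochastic hp0 hp1 π₀ ρ)
      (fun s => ?_) (fun s => (hfix π₀ ρ s).ge) s
    rw [rPol_add_discounted_mulVec, ← hc s]
    exact hπ₀ s (ρ s)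
  · refine le_of_discounted_comparison hγ0 hγ1 (PPol_mem_rowStochastic hp0 hp1 π ρ₀)
      (fun s => (hfix π ρ₀ s).le) (fun s => ?_) s
    rw [rPol_add_discounted_mulVec, ← hc s]
    exact hρ₀ s (π s)
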